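/- Let p_n denote the n-th prime number. Then p_{p_n} ~ n·(log n)² as n → ∞, i.e. the ratio p_{p_n} / (n·(log n)²) tends to 1. -/

import Mathlib

open Filter Real

/-- `nthPrime n` is the `n`-th prime with 1-based indexing: `nthPrime 1 = 2`. -/
noncomputable def nthPrime (n : ℕ) : ℕ := Nat.nth Nat.Prime (n - 1)

open MeasureTheory Set Topology

theorem integral_triangle_mul_cexp (v : ℝ) :
    ∫ ξ in (-1 : ℝ)..1, ((1 - |ξ| : ℝ) : ℂ) * Complex.exp (Complex.I * v * ξ) =
      ((sinc (v / 2) ^ 2 : ℝ) : ℂ) := by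
  have hint (a b : ℝ) : IntervalIntegrable
      (fun ξ : ℝ => ((1 - |ξ| : ℝ) : ℂ) * Complex.exp (Complex.I * v * ξ)) volume a b :=
    (by fun_prop : Continuous _).intervalIntegrable a b
  rw [← intervalIntegral.integral_add_adjacent_intervals (hint (-1) 0) (hint 0 1)]
  have h₁ : ∫ ξ in (-1 : ℝ)..0, ((1 - |ξ| : ℝ) : ℂ) * Complex.exp (Complex.I * v * ξ) =
      ∫ ξ in (-1 : ℝ)..0, (1 + (ξ : ℂ)) * Complex.exp (Complex.I * v * ξ) := by
    refine intervalIntegral.integral_congr fun ξ hξ => ?_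
    rw [uIcc_of_le (by norm_num)] at hξ
    simp [abs_of_nonpos hξ.2]
  have h₂ : ∫ ξ in (0 : ℝ)..1, ((1 - |ξ| : ℝ) : ℂ) * Complex.exp (Complex.I * v * ξ) =
      ∫ ξ in (0 : ℝ)..1, (1 - (ξ : ℂ)) * Complex.exp (Complex.I * v * ξ) := by
    refine intervalIntegral.integral_congr fun ξ hξ => ?_
    rw [uIcc_of_le (by norm_num)] at hξ
    simp [abs_of_nonneg hξ.1]
  rw [h₁, h₂]
  have hid (ξ : ℝ) : HasDerivAt (fun x : ℝ => (x : ℂ)) 1 ξ := Complex.ofRealCLM.hasDerivAt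
  rcases eq_or_ne v 0 with rfl | hv
  · have e₁ : ∫ ξ in (-1 : ℝ)..0, (1 + (ξ : ℂ)) = 1 / 2 := by
      rw [intervalIntegral.integral_eq_sub_of_hasDerivAt
        (f := fun ξ : ℝ => (ξ : ℂ) + (ξ : ℂ) ^ 2 / 2)
        (fun ξ _ => ((hid ξ).add (((hid ξ).pow 2).div_const 2)).congr_deriv (by simp))
        ((by fun_prop : Continuous _).intervalIntegrable _ _)]
      push_cast; ring
    have e₂ : ∫ ξ in (0 : ℝ)..1, (1 - (ξ : ℂ)) = 1 / 2 := by
      rw [intervalIntegral.integral_eq_sub_of_hasDerivAt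
        (f := fun ξ : ℝ => (ξ : ℂ) - (ξ : ℂ) ^ 2 / 2)
        (fun ξ _ => ((hid ξ).sub (((hid ξ).pow 2).div_const 2)).congr_deriv (by simp))
        ((by fun_prop : Continuous _).intervalIntegrable _ _)]
      push_cast; ring
    simp only [Complex.ofReal_zero, mul_zero, zero_mul, Complex.exp_zero, mul_one, e₁, e₂]
    norm_num
  · set a : ℂ := Complex.I * v with ha
    have ha0 : a ≠ 0 := by simp [ha, hv]
    have hexp (ξ : ℝ) : HasDerivAt (fun x : ℝ => Complex.exp (a * x))
        (Complex.exp (a * ξ) * a) ξ := by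
      simpa using ((hid ξ).const_mul a).cexp
    have e₁ : ∫ ξ in (-1 : ℝ)..0, (1 + (ξ : ℂ)) * Complex.exp (a * ξ) =
        1 / a - 1 / a ^ 2 + Complex.exp (-a) / a ^ 2 := by
      rw [intervalIntegral.integral_eq_sub_of_hasDerivAt
        (f := fun ξ : ℝ => (1 + (ξ : ℂ)) * Complex.exp (a * ξ) / a - Complex.exp (a * ξ) / a ^ 2)
        (fun ξ _ => (((((hid ξ).const_add 1).mul (hexp ξ)).div_const a).sub
          ((hexp ξ).div_const (a ^ 2))).congr_deriv (by field_simp; ring))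
        ((by fun_prop : Continuous _).intervalIntegrable _ _)]
      simp
    have e₂ : ∫ ξ in (0 : ℝ)..1, (1 - (ξ : ℂ)) * Complex.exp (a * ξ) =
        Complex.exp a / a ^ 2 - 1 / a - 1 / a ^ 2 := by
      rw [intervalIntegral.integral_eq_sub_of_hasDerivAt
        (f := fun ξ : ℝ => (1 - (ξ : ℂ)) * Complex.exp (a * ξ) / a + Complex.exp (a * ξ) / a ^ 2)
        (fun ξ _ => (((((hid ξ).const_sub 1).mul (hexp ξ)).div_const a).add
          ((hexp ξ).div_const (a ^ 2))).congr_deriv (by field_simp; ring))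
        ((by fun_prop : Continuous _).intervalIntegrable _ _)]
      simp; ring
    rw [e₁, e₂, sinc_of_ne_zero (by positivity)]
    have hcos : Complex.exp a + Complex.exp (-a) = 2 * (Complex.cos v) := by
      rw [Complex.two_cos, ha, mul_comm, neg_mul]
    have hsin : Complex.cos v = 1 - 2 * Complex.sin (v / 2) ^ 2 := by
      rw [← Complex.cos_sq_add_sin_sq (v / 2 : ℂ)]
      conv_lhs => rw [show (v : ℂ) = 2 * (v / 2) by ring, Complex.cos_two_mul']
      ring
    have ha2 : a ^ 2 = - (v : ℂ) ^ 2 := by rw [ha, mul_pow, Complex.I_sq]; ring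
    have hv' : (v : ℂ) ≠ 0 := by exact_mod_cast hv
    calc _ = (Complex.exp a + Complex.exp (-a) - 2) / a ^ 2 := by ring
      _ = _ := by
        rw [hcos, hsin, ha2]; push_cast; field_simp; ring

theorem sinc_half_sq_le (v : ℝ) : sinc (v / 2) ^ 2 ≤ 5 * (1 + v ^ 2)⁻¹ := by
  rw [← div_eq_mul_inv, le_div_iff₀ (by positivity)]
  have h₁ : sinc (v / 2) ^ 2 ≤ 1 := by
    rw [sq_le_one_iff_abs_le_one]; exact abs_sinc_le_one _
  have h₂ : (v / 2 * sinc (v / 2)) ^ 2 ≤ 1 := by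
    rcases eq_or_ne (v / 2) 0 with h | h
    · simp [h]
    · rw [sinc_of_ne_zero h, mul_div_cancel₀ _ h, sq_le_one_iff_abs_le_one]
      exact abs_sin_le_one _
  nlinarith

theorem integrable_sinc_half_sq : Integrable (fun v : ℝ => sinc (v / 2) ^ 2) := by
  refine (integrable_inv_one_add_sq.const_mul 5).mono'
    (by fun_prop : Continuous _).aestronglyMeasurable (Eventually.of_forall fun v => ?_)
  rw [norm_of_nonneg (by positivity)]
  exact sinc_half_sq_le v

theorem integral_sinc_half_sq_pos : 0 < ∫ v : ℝ, sinc (v / 2) ^ 2 := by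
  have hc : Continuous fun v : ℝ => sinc (v / 2) ^ 2 := by fun_prop
  rw [integral_pos_iff_support_of_nonneg (fun v => by positivity) integrable_sinc_half_sq]
  exact hc.isOpen_support.measure_pos volume ⟨0, by simp⟩

theorem integral_mul_sinc_half_sq_eq_integral_laplace {f : ℝ → ℂ} {M : ℝ} (hf : Measurable f)
    (hM : ∀ t, ‖f t‖ ≤ M) {ε : ℝ} (hε : 0 < ε) (l x : ℝ) :
    ∫ t in Ioi (0 : ℝ), f t * Complex.exp (-ε * t) * ((sinc (l * (x - t) / 2) ^ 2 : ℝ) : ℂ) =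
      ∫ ξ in Ioc (-1 : ℝ) 1, ((1 - |ξ| : ℝ) : ℂ) * Complex.exp (Complex.I * (l * x : ℝ) * ξ) *
        ∫ t in Ioi (0 : ℝ), f t * Complex.exp (-(ε + Complex.I * l * ξ) * t) := by
  have hg : Integrable (fun t : ℝ => f t * Complex.exp (-ε * t))
      (volume.restrict (Ioi 0)) := by
    refine ((exp_neg_integrableOn_Ioi 0 hε).const_mul M).mono'
      (by fun_prop : Measurable _).aestronglyMeasurable (Eventually.of_forall fun t => ?_)
    rw [norm_mul, Complex.norm_exp]
    simpa using mul_le_mul_of_nonneg_right (hM t) (exp_pos (-(ε * t))).le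
  have hT : Integrable (fun ξ : ℝ => ((1 - |ξ| : ℝ) : ℂ)) (volume.restrict (Ioc (-1) 1)) :=
    ((by fun_prop : Continuous _).integrableOn_Icc).mono_set Ioc_subset_Icc_self
  have hprod := (hg.mul_prod hT).mul_bdd (c := 1)
    (g := fun z => Complex.exp (Complex.I * (l * (x - z.1) : ℝ) * z.2))
    (by fun_prop : Continuous _).aestronglyMeasurable
    (Eventually.of_forall fun z => by
      rw [Complex.norm_exp]; simp)
  have hswap := integral_integral_swap (f := fun t ξ : ℝ => f t * Complex.exp (-ε * t) *
    ((1 - |ξ| : ℝ) : ℂ) * Complex.exp (Complex.I * (l * (x - t) : ℝ) * ξ)) hprod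
  calc _ = ∫ t in Ioi (0 : ℝ), ∫ ξ in Ioc (-1 : ℝ) 1, f t * Complex.exp (-ε * t) *
        ((1 - |ξ| : ℝ) : ℂ) * Complex.exp (Complex.I * (l * (x - t) : ℝ) * ξ) := by
        congr 1 with t
        rw [← integral_triangle_mul_cexp, intervalIntegral.integral_of_le (by norm_num),
          ← integral_const_mul]
        simp only [mul_assoc]
    _ = _ := by
        rw [hswap]
        congr 1 with ξ
        rw [← integral_const_mul]
        congr 1 with t
        have : Complex.exp (-ε * t) * Complex.exp (Complex.I * (l * (x - t) : ℝ) * ξ) =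
            Complex.exp (Complex.I * (l * x : ℝ) * ξ) *
              Complex.exp (-(ε + Complex.I * l * ξ) * t) := by
          rw [← Complex.exp_add, ← Complex.exp_add]; congr 1; push_cast; ring
        linear_combination f t * ((1 - |ξ| : ℝ) : ℂ) * this

theorem integrable_sinc_half_sq_comp {l : ℝ} (hl : l ≠ 0) (x : ℝ) :
    Integrable fun t : ℝ => sinc (l * (x - t) / 2) ^ 2 :=
  (integrable_sinc_half_sq.comp_mul_left' hl).comp_sub_left x

theorem integral_mul_sinc_half_sq_eq_integral_of_continuousOn {f : ℝ → ℂ} {M : ℝ}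
    (hf : Measurable f) (hM : ∀ t, ‖f t‖ ≤ M) {L : ℂ → ℂ} (hL : ContinuousOn L {s | 0 ≤ s.re})
    (hfL : ∀ s : ℂ, 0 < s.re → ∫ t in Ioi (0 : ℝ), f t * Complex.exp (-s * t) = L s)
    {l : ℝ} (hl : 0 < l) (x : ℝ) :
    ∫ t in Ioi (0 : ℝ), f t * ((sinc (l * (x - t) / 2) ^ 2 : ℝ) : ℂ) =
      ∫ ξ in Ioc (-1 : ℝ) 1, ((1 - |ξ| : ℝ) : ℂ) * Complex.exp (Complex.I * (l * x : ℝ) * ξ) *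
        L (Complex.I * l * ξ) := by
  have hleft : Tendsto (fun ε : ℝ => ∫ t in Ioi (0 : ℝ), f t * Complex.exp (-ε * t) *
      ((sinc (l * (x - t) / 2) ^ 2 : ℝ) : ℂ)) (𝓝[>] 0)
      (𝓝 (∫ t in Ioi (0 : ℝ), f t * ((sinc (l * (x - t) / 2) ^ 2 : ℝ) : ℂ))) := by
    refine tendsto_integral_filter_of_dominated_convergence
      (fun t => M * sinc (l * (x - t) / 2) ^ 2)
      (Eventually.of_forall fun ε => (by fun_prop : Measurable _).aestronglyMeasurable) ?_
      ((integrable_sinc_half_sq_comp hl.ne' x).const_mul M).integrableOn ?_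
    · filter_upwards [self_mem_nhdsWithin] with ε hε
      filter_upwards [ae_restrict_mem measurableSet_Ioi] with t ht
      have h₁ : ‖Complex.exp (-ε * t)‖ ≤ 1 := by
        rw [Complex.norm_exp, exp_le_one_iff]
        simpa using (mul_pos hε ht).le
      rw [norm_mul, norm_mul, Complex.norm_real, norm_of_nonneg (sq_nonneg _)]
      gcongr
      simpa using mul_le_mul (hM t) h₁ (norm_nonneg _) ((norm_nonneg _).trans (hM t))
    · refine Eventually.of_forall fun t => ?_
      have : Continuous fun ε : ℝ => f t * Complex.exp (-ε * t) *
        ((sinc (l * (x - t) / 2) ^ 2 : ℝ) : ℂ) := by fun_prop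
      simpa using (this.tendsto 0).mono_left nhdsWithin_le_nhds
  have hright : Tendsto (fun ε : ℝ => ∫ ξ in Ioc (-1 : ℝ) 1, ((1 - |ξ| : ℝ) : ℂ) *
      Complex.exp (Complex.I * (l * x : ℝ) * ξ) * L (ε + Complex.I * l * ξ)) (𝓝[>] 0)
      (𝓝 (∫ ξ in Ioc (-1 : ℝ) 1, ((1 - |ξ| : ℝ) : ℂ) *
        Complex.exp (Complex.I * (l * x : ℝ) * ξ) * L (Complex.I * l * ξ))) := by
    obtain ⟨C, hC⟩ := ((isCompact_Icc (a := (0 : ℝ)) (b := 1)).reProdIm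
      (isCompact_Icc (a := -l) (b := l))).exists_bound_of_continuousOn
      (hL.mono fun s hs => hs.1.1)
    refine tendsto_integral_filter_of_dominated_convergence (fun _ => C) ?_ ?_
      (integrable_const _) ?_
    · filter_upwards [self_mem_nhdsWithin] with ε hε
      have : Continuous fun ξ : ℝ => L (ε + Complex.I * l * ξ) :=
        hL.comp_continuous (by fun_prop) fun ξ => by simpa using (mem_Ioi.1 hε).le
      exact ((by fun_prop : Continuous fun ξ : ℝ => ((1 - |ξ| : ℝ) : ℂ) *
        Complex.exp (Complex.I * (l * x : ℝ) * ξ)).mul this).aestronglyMeasurable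
    · filter_upwards [Ioo_mem_nhdsGT one_pos] with ε hε
      filter_upwards [ae_restrict_mem measurableSet_Ioc] with ξ hξ
      have h₁ : ‖((1 - |ξ| : ℝ) : ℂ)‖ ≤ 1 := by
        have := abs_le.2 ⟨hξ.1.le, hξ.2⟩
        rw [Complex.norm_real, norm_of_nonneg (by linarith)]
        linarith [abs_nonneg ξ]
      have h₂ : ‖Complex.exp (Complex.I * (l * x : ℝ) * ξ)‖ = 1 := by
        rw [Complex.norm_exp]; simp
      have h₃ := hC (ε + Complex.I * l * ξ) ⟨by simpa using ⟨hε.1.le, hε.2.le⟩, by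
        simp only [mem_preimage, mem_Icc, Complex.add_im, Complex.ofReal_im, zero_add,
          Complex.mul_im, Complex.mul_re, Complex.I_re, Complex.I_im, Complex.ofReal_re]
        constructor <;> nlinarith [hξ.1, hξ.2]⟩
      rw [norm_mul, norm_mul, h₂, mul_one]
      simpa using mul_le_mul h₁ h₃ (norm_nonneg _) zero_le_one
    · refine Eventually.of_forall fun ξ => Tendsto.const_mul _ ?_
      have h₀ : Tendsto (fun ε : ℝ => (ε : ℂ) + Complex.I * l * ξ) (𝓝[>] 0)
          (𝓝 (Complex.I * l * ξ)) := by
        have : Continuous fun ε : ℝ => (ε : ℂ) + Complex.I * l * ξ := by fun_prop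
        simpa using (this.tendsto 0).mono_left nhdsWithin_le_nhds
      refine (hL (Complex.I * l * ξ) (by simp)).tendsto.comp
        (tendsto_nhdsWithin_iff.2 ⟨h₀, ?_⟩)
      filter_upwards [self_mem_nhdsWithin] with ε hε
      simpa using (mem_Ioi.1 hε).le
  refine tendsto_nhds_unique hleft (hright.congr' ?_)
  filter_upwards [self_mem_nhdsWithin] with ε hε
  rw [integral_mul_sinc_half_sq_eq_integral_laplace hf hM hε]
  congr 1 with ξ
  rw [hfL _ (by simpa using hε)]

theorem tendsto_integral_mul_sinc_half_sq_zero {f : ℝ → ℂ} {M : ℝ}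
    (hf : Measurable f) (hM : ∀ t, ‖f t‖ ≤ M) {L : ℂ → ℂ} (hL : ContinuousOn L {s | 0 ≤ s.re})
    (hfL : ∀ s : ℂ, 0 < s.re → ∫ t in Ioi (0 : ℝ), f t * Complex.exp (-s * t) = L s)
    {l : ℝ} (hl : 0 < l) :
    Tendsto (fun x : ℝ => ∫ t in Ioi (0 : ℝ), f t * ((sinc (l * (x - t) / 2) ^ 2 : ℝ) : ℂ))
      atTop (𝓝 0) := by
  simp_rw [integral_mul_sinc_half_sq_eq_integral_of_continuousOn hf hM hL hfL hl]
  have hw : Tendsto (fun x : ℝ => -(l / (2 * π)) * x) atTop (cocompact ℝ) :=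
    (tendsto_id.const_mul_atTop_of_neg (by simpa using by positivity)).mono_right
      atBot_le_cocompact
  refine ((Real.tendsto_integral_exp_smul_cocompact ((Ioc (-1 : ℝ) 1).indicator fun ξ =>
    ((1 - |ξ| : ℝ) : ℂ) * L (Complex.I * l * ξ))).comp hw).congr fun x => ?_
  rw [← integral_indicator measurableSet_Ioc, Function.comp_apply]
  congr 1 with ξ
  by_cases hξ : ξ ∈ Ioc (-1 : ℝ) 1
  · rw [indicator_of_mem hξ, indicator_of_mem hξ, Circle.smul_def, Real.fourierChar_apply,
      smul_eq_mul]
    have : ((2 * π * -(ξ * (-(l / (2 * π)) * x)) : ℝ) : ℂ) * Complex.I =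
        Complex.I * (l * x : ℝ) * ξ := by
      have : 2 * π * -(ξ * (-(l / (2 * π)) * x)) = l * x * ξ := by field_simp
      rw [this]; push_cast; ring
    rw [this]; ring
  · simp [indicator_of_notMem hξ]

theorem tendsto_integral_Ioi_sinc_half_sq {l : ℝ} (hl : 0 < l) :
    Tendsto (fun x : ℝ => ∫ t in Ioi (0 : ℝ), sinc (l * (x - t) / 2) ^ 2) atTop
      (𝓝 (l⁻¹ * ∫ v : ℝ, sinc (v / 2) ^ 2)) := by
  have h := (aecover_Iio (μ := volume) tendsto_id).integral_tendsto_of_countably_generated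
    (integrable_sinc_half_sq.comp_mul_left' hl.ne')
  have hc := Measure.integral_comp_mul_left (fun v : ℝ => sinc (v / 2) ^ 2) l
  rw [abs_of_pos (inv_pos.2 hl), smul_eq_mul] at hc
  rw [hc] at h
  refine h.congr fun x => ?_
  rw [← integral_indicator measurableSet_Iio, ← integral_indicator measurableSet_Ioi,
    ← integral_sub_left_eq_self _ volume x]
  congr 1 with t
  simp [indicator_apply]

theorem integral_Ioc_sinc_half_sq {l : ℝ} (hl : 0 < l) (δ y : ℝ) (hδ : 0 ≤ δ) :
    ∫ t in Ioc (y - δ) (y + δ), sinc (l * (y - t) / 2) ^ 2 =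
      l⁻¹ * ∫ v in (-(l * δ))..(l * δ), sinc (v / 2) ^ 2 := by
  rw [← intervalIntegral.integral_of_le (by linarith)]
  have := intervalIntegral.integral_comp_sub_mul (fun v : ℝ => sinc (v / 2) ^ 2) hl.ne' (l * y)
    (a := y - δ) (b := y + δ)
  rw [smul_eq_mul] at this
  simp only [mul_sub]
  convert this using 3 <;> ring

theorem integrable_mul_sinc_half_sq {B : ℝ → ℝ} {M : ℝ} (hB : Measurable B)
    (hB₀ : ∀ t, 0 ≤ B t) (hBM : ∀ t, B t ≤ M) {l : ℝ} (hl : 0 < l) (y : ℝ) :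
    Integrable fun t : ℝ => B t * sinc (l * (y - t) / 2) ^ 2 :=
  (integrable_sinc_half_sq_comp hl.ne' y).bdd_mul (c := M) hB.aestronglyMeasurable
    (Eventually.of_forall fun t => by rw [norm_of_nonneg (hB₀ t)]; exact hBM t)

theorem mul_integral_le_integral_mul_sinc_half_sq {B : ℝ → ℝ} {M : ℝ} (hB : Measurable B)
    (hB₀ : ∀ t, 0 ≤ B t) (hBM : ∀ t, B t ≤ M) (hmono : ∀ t u, t ≤ u → B t * exp t ≤ B u * exp u)
    {l δ x : ℝ} (hl : 0 < l) (hδ : 0 ≤ δ)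
    (hx : 0 ≤ x) :
    exp (-(2 * δ)) * B x * ∫ v in (-(l * δ))..(l * δ), sinc (v / 2) ^ 2 ≤
      l * ∫ t in Ioi (0 : ℝ), B t * sinc (l * (x + δ - t) / 2) ^ 2 := by
  have hint := integrable_mul_sinc_half_sq hB hB₀ hBM hl (x + δ)
  have h := integral_Ioc_sinc_half_sq hl δ (x + δ) hδ
  rw [show ∫ v in (-(l * δ))..(l * δ), sinc (v / 2) ^ 2 =
      l * ∫ t in Ioc (x + δ - δ) (x + δ + δ), sinc (l * (x + δ - t) / 2) ^ 2 by
    rw [h]; field_simp, mul_left_comm, ← integral_const_mul]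
  refine mul_le_mul_of_nonneg_left ?_ hl.le
  calc _ ≤ ∫ t in Ioc (x + δ - δ) (x + δ + δ), B t * sinc (l * (x + δ - t) / 2) ^ 2 := by
        refine setIntegral_mono_on
          ((integrable_sinc_half_sq_comp hl.ne' _).const_mul _).integrableOn hint.integrableOn
          measurableSet_Ioc fun t ht => mul_le_mul_of_nonneg_right ?_ (sq_nonneg _)
        have h₁ := hmono x t (by linarith [ht.1])
        rw [← mul_le_mul_iff_left₀ (exp_pos t)]
        refine le_trans ?_ h₁
        rw [mul_right_comm, mul_comm, ← exp_add]
        exact mul_le_mul_of_nonneg_left (exp_le_exp.2 (by linarith [ht.2])) (hB₀ x)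
    _ ≤ _ := setIntegral_mono_set hint.integrableOn
        (Eventually.of_forall fun t => mul_nonneg (hB₀ t) (sq_nonneg _))
        (Filter.Eventually.of_forall fun t ht => by
          have : x + δ - δ < t := ht.1
          change 0 < t
          linarith)

theorem integral_mul_sinc_half_sq_le {B : ℝ → ℝ} {M : ℝ} (hB : Measurable B)
    (hB₀ : ∀ t, 0 ≤ B t) (hBM : ∀ t, B t ≤ M) (hmono : ∀ t u, t ≤ u → B t * exp t ≤ B u * exp u)
    {l δ x : ℝ} (hl : 0 < l) (hδ : 0 ≤ δ) :
    l * ∫ t in Ioi (0 : ℝ), B t * sinc (l * (x - δ - t) / 2) ^ 2 ≤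
      exp (2 * δ) * B x * (∫ v in (-(l * δ))..(l * δ), sinc (v / 2) ^ 2) +
        M * ((∫ v : ℝ, sinc (v / 2) ^ 2) -
          ∫ v in (-(l * δ))..(l * δ), sinc (v / 2) ^ 2) := by
  have hint := integrable_mul_sinc_half_sq hB hB₀ hBM hl (x - δ)
  have hintK := integrable_sinc_half_sq_comp hl.ne' (x - δ)
  have h := integral_Ioc_sinc_half_sq hl δ (x - δ) hδ
  set S := Ioc (x - δ - δ) (x - δ + δ)
  have hc : ∫ t : ℝ, sinc (l * (x - δ - t) / 2) ^ 2 = l⁻¹ * ∫ v : ℝ, sinc (v / 2) ^ 2 := by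
    rw [integral_sub_left_eq_self (fun t : ℝ => sinc (l * t / 2) ^ 2) volume (x - δ),
      Measure.integral_comp_mul_left (fun v : ℝ => sinc (v / 2) ^ 2) l,
      abs_of_pos (inv_pos.2 hl), smul_eq_mul]
  have hcompl := integral_add_compl (s := S) measurableSet_Ioc hintK
  rw [h, hc] at hcompl
  have h₁ : ∫ t in S, B t * sinc (l * (x - δ - t) / 2) ^ 2 ≤
      ∫ t in S, exp (2 * δ) * B x * sinc (l * (x - δ - t) / 2) ^ 2 := by
    refine setIntegral_mono_on hint.integrableOn (hintK.const_mul _).integrableOn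
      measurableSet_Ioc fun t ht => mul_le_mul_of_nonneg_right ?_ (sq_nonneg _)
    have h₁ := hmono t x (by linarith [ht.2])
    rw [← mul_le_mul_iff_left₀ (exp_pos t)]
    refine h₁.trans ?_
    rw [mul_right_comm, mul_comm, ← exp_add]
    exact mul_le_mul_of_nonneg_right (exp_le_exp.2 (by linarith [ht.1])) (hB₀ x)
  have h₂ : ∫ t in Sᶜ, B t * sinc (l * (x - δ - t) / 2) ^ 2 ≤
      ∫ t in Sᶜ, M * sinc (l * (x - δ - t) / 2) ^ 2 :=
    setIntegral_mono_on hint.integrableOn (hintK.const_mul _).integrableOn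
      measurableSet_Ioc.compl fun t _ => mul_le_mul_of_nonneg_right (hBM t) (sq_nonneg _)
  have h₃ : ∫ t in Ioi (0 : ℝ), B t * sinc (l * (x - δ - t) / 2) ^ 2 ≤
      ∫ t : ℝ, B t * sinc (l * (x - δ - t) / 2) ^ 2 :=
    setIntegral_le_integral hint
      (Eventually.of_forall fun t => mul_nonneg (hB₀ t) (sq_nonneg _))
  rw [← integral_add_compl (s := S) measurableSet_Ioc hint] at h₃
  rw [integral_const_mul] at h₁ h₂
  rw [h] at h₁
  rw [← eq_sub_iff_add_eq'] at hcompl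
  rw [hcompl] at h₂
  calc _ ≤ l * (exp (2 * δ) * B x * (l⁻¹ * ∫ v in (-(l * δ))..(l * δ), sinc (v / 2) ^ 2) +
        M * (l⁻¹ * (∫ v : ℝ, sinc (v / 2) ^ 2) -
          l⁻¹ * ∫ v in (-(l * δ))..(l * δ), sinc (v / 2) ^ 2)) := by
        gcongr; linarith
    _ = _ := by field_simp

theorem tendsto_one_of_tendsto_integral_mul_sinc_half_sq {B : ℝ → ℝ} {M : ℝ} (hB : Measurable B)
    (hB₀ : ∀ t, 0 ≤ B t) (hBM : ∀ t, B t ≤ M) (hmono : ∀ t u, t ≤ u → B t * exp t ≤ B u * exp u)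
    (h : ∀ l : ℝ, 0 < l → Tendsto
      (fun x : ℝ => ∫ t in Ioi (0 : ℝ), (B t - 1) * sinc (l * (x - t) / 2) ^ 2) atTop (𝓝 0)) :
    Tendsto B atTop (𝓝 1) := by
  set c := ∫ v : ℝ, sinc (v / 2) ^ 2 with hc
  have hc₀ : 0 < c := integral_sinc_half_sq_pos
  have hA (l : ℝ) (hl : 0 < l) : Tendsto
      (fun x : ℝ => l * ∫ t in Ioi (0 : ℝ), B t * sinc (l * (x - t) / 2) ^ 2) atTop (𝓝 c) := by
    have := ((h l hl).add (tendsto_integral_Ioi_sinc_half_sq hl)).const_mul l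
    rw [zero_add, mul_inv_cancel_left₀ hl.ne'] at this
    refine this.congr fun x => ?_
    rw [← integral_add]
    · congr 2 with t; ring
    · simp only [sub_mul, one_mul]
      exact ((integrable_mul_sinc_half_sq hB hB₀ hBM hl x).sub
        (integrable_sinc_half_sq_comp hl.ne' x)).integrableOn
    · exact (integrable_sinc_half_sq_comp hl.ne' x).integrableOn
  have hr : Tendsto (fun δ : ℝ => ∫ v in (-δ⁻¹)..δ⁻¹, sinc (v / 2) ^ 2) (𝓝[>] 0) (𝓝 c) :=
    intervalIntegral_tendsto_integral integrable_sinc_half_sq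
      (tendsto_neg_atTop_atBot.comp tendsto_inv_nhdsGT_zero) tendsto_inv_nhdsGT_zero
  have hδ : Tendsto (fun δ : ℝ => δ) (𝓝[>] 0) (𝓝 0) := nhdsWithin_le_nhds
  have he : Tendsto (fun δ : ℝ => exp (2 * δ)) (𝓝[>] 0) (𝓝 1) := by
    simpa using (hδ.const_mul 2).rexp
  have hup : Tendsto (fun δ : ℝ => exp (2 * δ) * (c + δ) /
      ∫ v in (-δ⁻¹)..δ⁻¹, sinc (v / 2) ^ 2) (𝓝[>] 0) (𝓝 1) := by
    simpa [hc₀.ne', Pi.div_def] using (he.mul (hδ.const_add c)).div hr hc₀.ne'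
  have hlow : Tendsto (fun δ : ℝ => (c - δ - M * (c - ∫ v in (-δ⁻¹)..δ⁻¹, sinc (v / 2) ^ 2)) /
      (exp (2 * δ) * ∫ v in (-δ⁻¹)..δ⁻¹, sinc (v / 2) ^ 2)) (𝓝[>] 0) (𝓝 1) := by
    have := ((hδ.const_sub c).sub ((hr.const_sub c).const_mul M)).div (he.mul hr)
      (by simpa using hc₀.ne')
    simpa [hc₀.ne', Pi.div_def] using this
  rw [tendsto_order]
  constructor
  · intro a ha
    obtain ⟨δ, ⟨hδa, hrδ⟩, hδ₀⟩ := (((hlow.eventually (lt_mem_nhds ha)).and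
      (hr.eventually (lt_mem_nhds hc₀))).and self_mem_nhdsWithin).exists
    replace hδ₀ : 0 < δ := hδ₀
    have hl : 0 < (δ ^ 2)⁻¹ := by positivity
    have hlδ : (δ ^ 2)⁻¹ * δ = δ⁻¹ := by field_simp
    filter_upwards [((hA _ hl).comp (tendsto_atTop_add_const_right atTop (-δ)
      tendsto_id)).eventually (lt_mem_nhds (sub_lt_self c hδ₀))] with x hx
    have := integral_mul_sinc_half_sq_le hB hB₀ hBM hmono hl hδ₀.le (x := x)
    simp only [Function.comp_apply, id, ← sub_eq_add_neg] at hx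
    rw [hlδ] at this
    refine hδa.trans ?_
    rw [div_lt_iff₀ (by positivity)]
    linarith
  · intro a ha
    obtain ⟨δ, ⟨hδa, hrδ⟩, hδ₀⟩ := (((hup.eventually (gt_mem_nhds ha)).and
      (hr.eventually (lt_mem_nhds hc₀))).and self_mem_nhdsWithin).exists
    replace hδ₀ : 0 < δ := hδ₀
    have hl : 0 < (δ ^ 2)⁻¹ := by positivity
    have hlδ : (δ ^ 2)⁻¹ * δ = δ⁻¹ := by field_simp
    filter_upwards [((hA _ hl).comp (tendsto_atTop_add_const_right atTop δ
      tendsto_id)).eventually (gt_mem_nhds (lt_add_of_pos_right c hδ₀)),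
      eventually_ge_atTop 0] with x hx hx₀
    have := mul_integral_le_integral_mul_sinc_half_sq hB hB₀ hBM hmono hl hδ₀.le hx₀
    simp only [Function.comp_apply, id] at hx
    rw [hlδ] at this
    refine lt_of_le_of_lt ?_ hδa
    rw [le_div_iff₀ hrδ]
    have h₂ : exp (2 * δ) * exp (-(2 * δ)) = 1 := by rw [← exp_add]; simp
    calc _ = exp (2 * δ) * (exp (-(2 * δ)) * B x *
          ∫ v in (-δ⁻¹)..δ⁻¹, sinc (v / 2) ^ 2) := by
          linear_combination -(B x * ∫ v in (-δ⁻¹)..δ⁻¹, sinc (v / 2) ^ 2) * h₂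
      _ ≤ _ := by gcongr; linarith

open ArithmeticFunction.vonMangoldt in
theorem LSeries_vonMangoldt_eq_residueClassAux {s : ℂ} (hs : 1 < s.re) :
    LSeries (fun n => (ArithmeticFunction.vonMangoldt n : ℂ)) s =
      LFunctionResidueClassAux (1 : ZMod 1) s + 1 / (s - 1) := by
  rw [eqOn_LFunctionResidueClassAux isUnit_one hs]
  have : residueClass (1 : ZMod 1) = ArithmeticFunction.vonMangoldt := by
    ext n
    simp [residueClass, Subsingleton.elim (n : ZMod 1) 1]
  simp [this]

open Chebyshev in
theorem LSeries_vonMangoldt_eq_mul_integral_psi {s : ℂ} (hs : 1 < s.re) :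
    LSeries (fun n => (ArithmeticFunction.vonMangoldt n : ℂ)) s =
      s * ∫ t in Ioi (1 : ℝ), (psi t : ℂ) * (t : ℂ) ^ (-(s + 1)) := by
  have hsum (n : ℕ) : ∑ k ∈ Finset.Icc 1 n, ArithmeticFunction.vonMangoldt k = psi n := by
    rw [psi, Nat.floor_natCast, ← Finset.Icc_succ_left_eq_Ioc]; rfl
  rw [LSeries_eq_mul_integral_of_nonneg (fun n => ArithmeticFunction.vonMangoldt n) zero_le_one hs ?_
    fun n => ArithmeticFunction.vonMangoldt_nonneg]
  · congr 2 with t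
    rw [psi_eq_psi_coe_floor, ← hsum]
    push_cast; rfl
  · refine Asymptotics.IsBigO.of_bound (log 4 + 4) (Eventually.of_forall fun n => ?_)
    rw [hsum, rpow_one, norm_of_nonneg (psi_nonneg _), norm_of_nonneg n.cast_nonneg]
    exact psi_le_const_mul_self n.cast_nonneg

open Chebyshev in
theorem integral_psi_exp_mul_cexp {s : ℂ} :
    ∫ t in Ioi (0 : ℝ), ((psi (exp t) * exp (-t) : ℝ) : ℂ) * Complex.exp (-s * t) =
      ∫ t in Ioi (1 : ℝ), (psi t : ℂ) * (t : ℂ) ^ (-(s + 1 + 1)) := by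
  have := integral_comp_exp_Ioi (fun t : ℝ => (psi t : ℂ) * (t : ℂ) ^ (-(s + 1 + 1))) 0
  rw [exp_zero] at this
  rw [← this]
  congr 1 with t
  have h₁ : ((exp t : ℝ) : ℂ) ^ (-(s + 1 + 1)) = Complex.exp (-(s + 1 + 1) * t) := by
    rw [Complex.cpow_def_of_ne_zero (by exact_mod_cast (exp_pos t).ne'),
      ← Complex.ofReal_log (exp_pos t).le, log_exp, mul_comm]
  have h₂ : Complex.exp (-t) * Complex.exp (-s * t) =
      Complex.exp t * Complex.exp (-(s + 1 + 1) * t) := by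
    rw [← Complex.exp_add, ← Complex.exp_add]; congr 1; ring
  rw [h₁, Complex.real_smul]
  push_cast
  linear_combination (psi (exp t) : ℂ) * h₂

open Chebyshev in
theorem psi_exp_mul_exp_neg_le (t : ℝ) : psi (exp t) * exp (-t) ≤ log 4 + 4 := by
  rw [exp_neg, ← div_eq_mul_inv, div_le_iff₀ (exp_pos t)]
  exact psi_le_const_mul_self (exp_pos t).le

open Chebyshev in
theorem psi_exp_mul_exp_neg_nonneg (t : ℝ) : 0 ≤ psi (exp t) * exp (-t) :=
  mul_nonneg (psi_nonneg _) (exp_pos _).le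

open Chebyshev in
theorem measurable_psi_exp_mul_exp_neg : Measurable fun t : ℝ => psi (exp t) * exp (-t) :=
  (psi_mono.measurable.comp measurable_exp).mul (by fun_prop)

open ArithmeticFunction.vonMangoldt Chebyshev in
theorem integral_psi_exp_sub_one_mul_cexp {s : ℂ} (hs : 0 < s.re) :
    ∫ t in Ioi (0 : ℝ), ((psi (exp t) * exp (-t) - 1 : ℝ) : ℂ) * Complex.exp (-s * t) =
      (LFunctionResidueClassAux (1 : ZMod 1) (s + 1) - 1) / (s + 1) := by
  have hexp : IntegrableOn (fun t : ℝ => Complex.exp (-s * t)) (Ioi 0) :=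
    integrableOn_exp_mul_complex_Ioi (by simpa using hs) 0
  have hψ : IntegrableOn (fun t : ℝ =>
      ((psi (exp t) * exp (-t) : ℝ) : ℂ) * Complex.exp (-s * t)) (Ioi 0) := by
    refine hexp.bdd_mul (c := log 4 + 4)
      (Complex.measurable_ofReal.comp measurable_psi_exp_mul_exp_neg).aestronglyMeasurable
      (Eventually.of_forall fun t => ?_)
    rw [Complex.norm_real, norm_of_nonneg (psi_exp_mul_exp_neg_nonneg t)]
    exact psi_exp_mul_exp_neg_le t
  have hs₀ : s ≠ 0 := fun h => by simp [h] at hs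
  have hs₁ : s + 1 ≠ 0 := fun h => by
    have := congrArg Complex.re h
    simp at this; linarith
  have h₁ := LSeries_vonMangoldt_eq_mul_integral_psi (s := s + 1) (by simpa using hs)
  rw [LSeries_vonMangoldt_eq_residueClassAux (by simpa using hs),
    ← integral_psi_exp_mul_cexp, add_sub_cancel_right] at h₁
  have h₂ := integral_exp_mul_complex_Ioi (a := -s) (by simpa using hs) 0
  simp only [Complex.ofReal_sub, Complex.ofReal_one, sub_mul, one_mul]
  rw [integral_sub hψ hexp, h₂, ← mul_right_inj' hs₁, mul_sub, ← h₁]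
  simp only [Complex.ofReal_zero, mul_zero, Complex.exp_zero]
  field_simp
  ring

open ArithmeticFunction.vonMangoldt Chebyshev in
theorem tendsto_psi_exp_mul_exp_neg :
    Tendsto (fun t : ℝ => psi (exp t) * exp (-t)) atTop (𝓝 1) := by
  refine tendsto_one_of_tendsto_integral_mul_sinc_half_sq measurable_psi_exp_mul_exp_neg
    psi_exp_mul_exp_neg_nonneg psi_exp_mul_exp_neg_le (fun t u htu => ?_) fun l hl => ?_
  · simpa [mul_assoc, ← exp_add] using psi_mono (exp_le_exp.2 htu)
  · have := tendsto_integral_mul_sinc_half_sq_zero (M := log 4 + 4 + 1)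
      (f := fun t => ((psi (exp t) * exp (-t) - 1 : ℝ) : ℂ))
      (L := fun s => (LFunctionResidueClassAux (1 : ZMod 1) (s + 1) - 1) / (s + 1))
      (Complex.measurable_ofReal.comp (measurable_psi_exp_mul_exp_neg.sub_const 1))
      (fun t => ?_) ?_ (fun s hs => integral_psi_exp_sub_one_mul_cexp hs) hl
    · rw [← Complex.ofReal_zero] at this
      simp_rw [← Complex.ofReal_mul, integral_complex_ofReal] at this
      exact tendsto_ofReal_iff.1 this
    · rw [Complex.norm_real, norm_eq_abs, abs_le]
      have h₁ := psi_exp_mul_exp_neg_nonneg t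
      have h₂ := psi_exp_mul_exp_neg_le t
      constructor <;> linarith
    · refine ContinuousOn.div (ContinuousOn.sub ?_ continuousOn_const) (by fun_prop)
        fun s (hs : 0 ≤ s.re) h => ?_
      · exact (continuousOn_LFunctionResidueClassAux (1 : ZMod 1)).comp (by fun_prop)
          fun s hs => by simpa using hs
      · have := congrArg Complex.re h
        simp at this; linarith

open Chebyshev in
/-- The **prime number theorem** for the Chebyshev function `ψ`. -/
theorem tendsto_psi_div_id : Tendsto (fun x : ℝ => psi x / x) atTop (𝓝 1) := by
  refine (tendsto_psi_exp_mul_exp_neg.comp tendsto_log_atTop).congr' ?_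
  filter_upwards [eventually_gt_atTop 0] with x hx
  simp [exp_neg, exp_log hx, div_eq_mul_inv]

open Chebyshev in
theorem tendsto_theta_div_id : Tendsto (fun x : ℝ => theta x / x) atTop (𝓝 1) := by
  have h : Tendsto (fun x : ℝ => (psi - theta) x / x) atTop (𝓝 0) := by
    refine (isBigO_psi_sub_theta_sqrt.trans_isLittleO ?_).tendsto_div_nhds_zero
    refine Asymptotics.isLittleO_of_tendsto' ?_
      ((tendsto_sqrt_atTop.inv_tendsto_atTop).congr' (Eventually.of_forall fun x => ?_))
    · filter_upwards [eventually_gt_atTop 0] with x hx h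
      exact absurd h hx.ne'
    · simp [sqrt_div_self]
  simpa [sub_div] using tendsto_psi_div_id.sub h

open Chebyshev in
/-- The **prime number theorem**. -/
theorem tendsto_primeCounting_mul_log_div :
    Tendsto (fun x : ℝ => (Nat.primeCounting ⌊x⌋₊ : ℝ) * log x / x) atTop (𝓝 1) := by
  have h : Tendsto (fun x : ℝ => (Nat.primeCounting ⌊x⌋₊ - theta x / log x) / (x / log x))
      atTop (𝓝 0) := by
    refine (primeCounting_sub_theta_div_log_isBigO.trans_isLittleO ?_).tendsto_div_nhds_zero
    refine Asymptotics.isLittleO_of_tendsto' ?_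
      (tendsto_log_atTop.inv_tendsto_atTop.congr' ?_)
    · filter_upwards [eventually_gt_atTop 1] with x hx h
      have := log_pos hx
      exact absurd h (by positivity)
    · filter_upwards [eventually_gt_atTop 1] with x hx
      have := log_pos hx
      simp only [Pi.inv_apply]
      field_simp
  have := h.add tendsto_theta_div_id
  rw [zero_add] at this
  refine this.congr' ?_
  filter_upwards [eventually_gt_atTop 1] with x hx
  have := log_pos hx
  field_simp
  ring

theorem tendsto_nthPrime_atTop : Tendsto nthPrime atTop atTop :=
  (Nat.nth_strictMono Nat.infinite_setOfPred_prime).tendsto_atTop.comp (tendsto_sub_atTop_nat 1)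

theorem primeCounting_nthPrime {n : ℕ} (hn : n ≠ 0) : Nat.primeCounting (nthPrime n) = n := by
  rw [nthPrime, Nat.primeCounting, Nat.primeCounting', Nat.count_succ,
    Nat.count_nth_of_infinite Nat.infinite_setOfPred_prime,
    if_pos (Nat.nth_mem_of_infinite Nat.infinite_setOfPred_prime _)]
  omega

theorem tendsto_mul_log_nthPrime_div :
    Tendsto (fun n : ℕ => (n : ℝ) * log (nthPrime n) / nthPrime n) atTop (𝓝 1) := by
  refine (tendsto_primeCounting_mul_log_div.comp
    (tendsto_natCast_atTop_atTop.comp tendsto_nthPrime_atTop)).congr' ?_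
  filter_upwards [eventually_ne_atTop 0] with n hn
  simp [primeCounting_nthPrime hn]

theorem tendsto_log_nthPrime_div_log :
    Tendsto (fun n : ℕ => log (nthPrime n) / log n) atTop (𝓝 1) := by
  have hp : Tendsto (fun n => (nthPrime n : ℝ)) atTop atTop :=
    tendsto_natCast_atTop_atTop.comp tendsto_nthPrime_atTop
  have hlp := tendsto_log_atTop.comp hp
  have h₁ : Tendsto (fun n : ℕ =>
      log ((n : ℝ) * log (nthPrime n) / nthPrime n) / log (nthPrime n)) atTop (𝓝 0) := by
    have := tendsto_mul_log_nthPrime_div.log one_ne_zero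
    rw [log_one] at this
    exact this.div_atTop hlp
  have h₂ : Tendsto (fun n : ℕ => log (log (nthPrime n)) / log (nthPrime n)) atTop (𝓝 0) :=
    isLittleO_log_id_atTop.tendsto_div_nhds_zero.comp hlp
  have h₃ : Tendsto (fun n : ℕ => log n / log (nthPrime n)) atTop (𝓝 1) := by
    have := (h₁.sub h₂).add_const 1
    norm_num at this
    refine this.congr' ?_
    filter_upwards [eventually_gt_atTop 0, hp.eventually_gt_atTop 1] with n hn hpn
    have hn' : (0 : ℝ) < n := by exact_mod_cast hn
    have hl := log_pos hpn
    rw [log_div (by positivity) (by positivity), log_mul (by positivity) (by positivity)]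
    field_simp
    ring
  simpa using h₃.inv₀ one_ne_zero

theorem tendsto_nthPrime_div_mul_log :
    Tendsto (fun n : ℕ => (nthPrime n : ℝ) / (n * log n)) atTop (𝓝 1) := by
  have hp : Tendsto (fun n => (nthPrime n : ℝ)) atTop atTop :=
    tendsto_natCast_atTop_atTop.comp tendsto_nthPrime_atTop
  have := (tendsto_mul_log_nthPrime_div.inv₀ one_ne_zero).mul tendsto_log_nthPrime_div_log
  rw [inv_one, mul_one] at this
  refine this.congr' ?_
  filter_upwards [eventually_gt_atTop 1, hp.eventually_gt_atTop 1] with n hn hpn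
  have hl := log_pos hpn
  have hn' : (1 : ℝ) < n := by exact_mod_cast hn
  have := log_pos hn'
  field_simp

/-- `p_{p_n} ~ n·(log n)²` as `n → ∞`. -/
theorem pip_asymptotic :
    Tendsto (fun n : ℕ => (nthPrime (nthPrime n) : ℝ) / (n * (Real.log n) ^ 2))
      atTop (nhds 1) := by
  have h := ((tendsto_nthPrime_div_mul_log.comp tendsto_nthPrime_atTop).mul
    tendsto_nthPrime_div_mul_log).mul tendsto_log_nthPrime_div_log
  rw [mul_one, mul_one] at h
  have hp : Tendsto (fun n => (nthPrime n : ℝ)) atTop atTop :=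
    tendsto_natCast_atTop_atTop.comp tendsto_nthPrime_atTop
  refine h.congr' ?_
  filter_upwards [eventually_gt_atTop 1, hp.eventually_gt_atTop 1] with n hn hpn
  have hl := log_pos hpn
  have hn' : (1 : ℝ) < n := by exact_mod_cast hn
  have := log_pos hn'
  simp only [Function.comp_apply]
  field_simp
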